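/- arXiv:1112.4981 — 4 statements merged into one kernel-verified Lean document; each statement's English description precedes it below -/
import Mathlib

section
/- For all (x₁,x₂) in a sufficiently small neighborhood of (0,0) in ℂ², the double series G_2(x₁,x₂) = ∑_{ℓ,m≥0} ((ℓ+m)!/(ℓ!m!))² x₁^ℓ x₂^m converges and equals 1/√(Q₂(x₁,x₂)), where Q₂(x₁,x₂) = (1 - x₁ - x₂)² - 4x₁x₂. -/
/-- `Q₂(x,y) = (1-x-y)² - 4xy`. -/
noncomputable def Q2 (x y : ℂ) : ℂ := (1 - x - y) ^ 2 - 4 * x * y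

lemma ring_choose_neg_half (n : ℕ) :
    Ring.choose (-(1/2) : ℂ) n * (-4) ^ n = (n.centralBinom : ℂ) := by
  induction n with
  | zero => simp
  | succ n ih =>
    have h1 : Ring.choose (-(1/2) : ℂ) (n+1) * (n+1) = Ring.choose (-(1/2) : ℂ) n * (-(1/2) - n) := by
      rw [Ring.choose_eq_smul, Ring.choose_eq_smul, descPochhammer_succ_right, Nat.factorial_succ]
      have : (n.factorial : ℂ) ≠ 0 := by exact_mod_cast n.factorial_ne_zero
      have h2 : (n + 1 : ℂ) ≠ 0 := by exact_mod_cast n.succ_ne_zero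
      simp only [Polynomial.smeval_mul, Polynomial.smeval_sub, Polynomial.smeval_X, Polynomial.smeval_natCast, smul_eq_mul]
      push_cast
      field_simp
      simp
      left; ring
    have h2 : ((n + 1 : ℕ) : ℂ) * ((n+1).centralBinom : ℂ) = 2 * (2 * n + 1) * n.centralBinom := by
      exact_mod_cast Nat.succ_mul_centralBinom_succ n
    have h3 : (n + 1 : ℂ) ≠ 0 := by exact_mod_cast n.succ_ne_zero
    apply mul_left_cancel₀ h3
    push_cast at h2
    rw [h2, ← ih, pow_succ]
    linear_combination (-4)^n * (-4) * h1

lemma hasSum_central (u : ℂ) (hu : ‖u‖ < 1/4) :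
    HasSum (fun k : ℕ => (k.centralBinom : ℂ) * u ^ k) (((1 - 4 * u) ^ ((1:ℂ)/2))⁻¹) := by
  have h := (Complex.one_add_cpow_hasFPowerSeriesOnBall_zero (a := -(1/2))).hasSum
    (y := -4 * u) (by
      rw [Metric.mem_eball, edist_zero_right, enorm_eq_nnnorm]
      have : ‖-4 * u‖₊ < 1 := by
        rw [← NNReal.coe_lt_coe]; simp; linarith
      exact_mod_cast this)
  simp only [binomialSeries_apply, Complex.cpow_neg, List.ofFn_const, List.prod_replicate, smul_eq_mul, mul_pow, ← mul_assoc, ring_choose_neg_half, zero_add] at h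
  rw [show 1 - 4 * u = 1 + -4 * u by ring]
  exact h

lemma cb_id (a b k : ℕ) : (a + k + (b + k)).choose (a+k) * (a+k).choose k * (b+k).choose k
    = k.centralBinom * ((a+b+2*k).choose (2*k) * (a+b).choose a) := by
  have e1 := Nat.add_choose_mul_factorial_mul_factorial (a+k) (b+k)
  have e2 := Nat.add_choose_mul_factorial_mul_factorial a k
  have e3 := Nat.add_choose_mul_factorial_mul_factorial b k
  have e4 := Nat.add_choose_mul_factorial_mul_factorial k k
  have e5 := Nat.add_choose_mul_factorial_mul_factorial (a+b) (2*k)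
  have e6 := Nat.add_choose_mul_factorial_mul_factorial a b
  rw [← Nat.choose_symm_add] at e1 e6
  rw [show a + k + (b + k) = a + b + 2 * k by ring] at *
  rw [Nat.centralBinom, two_mul] at *
  have p : 0 < a.factorial * b.factorial * k.factorial * k.factorial := by positivity
  have p1 := (a+k).factorial_pos
  have p2 := (b+k).factorial_pos
  have p3 := (k+k).factorial_pos
  have p4 := (a+b).factorial_pos
  apply Nat.eq_of_mul_eq_mul_right p
  trans (a + b + (k + k)).factorial
  · rw [← e1, ← e2, ← e3]; ring
  · rw [← e5, ← e4, ← e6]; ring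

lemma vand (l m : ℕ) : ∑ k ∈ Finset.range (l+1), l.choose k * m.choose k = (l+m).choose l := by
  rw [Nat.add_comm l m, Nat.add_choose_eq, Finset.Nat.sum_antidiagonal_eq_sum_range_succ_mk]
  refine Finset.sum_congr rfl fun k hk => ?_
  rw [Nat.choose_symm (by simp at hk; omega), mul_comm]

def T (x y : ℂ) (q : ℕ × (ℕ × ℕ)) : ℂ :=
  ((q.2.1 + q.2.2).choose q.2.1 * q.2.1.choose q.1 * q.2.2.choose q.1 : ℕ) * x ^ q.2.1 * y ^ q.2.2

lemma T_bound (x y : ℂ) (q : ℕ × (ℕ × ℕ)) :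
    ‖T x y q‖ ≤ (1/2)^q.1 * ((8 * ‖x‖)^q.2.1 * (8 * ‖y‖) ^ q.2.2) := by
  obtain ⟨k, l, m⟩ := q
  simp only [T, norm_mul, norm_pow, Complex.norm_natCast]
  have key : (((l + m).choose l * l.choose k * m.choose k : ℕ) : ℝ) ≤ (1/2)^k * (8^l * 8^m) := by
    by_cases hk : l < k
    · rw [Nat.choose_eq_zero_of_lt hk]; simp
    have h : (l + m).choose l * l.choose k * m.choose k * 2 ^ k ≤ 8^l * 8^m := by
      calc _ ≤ 2^(l+m) * 2^l * 2^m * 2^(l+m) := by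
            gcongr
            · exact Nat.choose_le_two_pow _ _
            · exact Nat.choose_le_two_pow _ _
            · exact Nat.choose_le_two_pow _ _
            · norm_num
            · omega
        _ = _ := by
            rw [show 8 = 2^3 by rfl, ← pow_mul, ← pow_mul]; ring
    have h' : (((l + m).choose l * l.choose k * m.choose k : ℕ) : ℝ) * 2 ^ k ≤ 8^l * 8^m := by
      exact_mod_cast h
    rw [one_div, inv_pow, inv_mul_eq_div, le_div_iff₀ (by positivity)]
    exact h'
  calc _ ≤ (1/2)^k * (8^l * 8^m) * ‖x‖^l * ‖y‖^m := by gcongr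
    _ = _ := by rw [mul_pow, mul_pow]; ring

lemma T_summable (x y : ℂ) (hx : ‖x‖ < 1/16) (hy : ‖y‖ < 1/16) : Summable (T x y) := by
  refine Summable.of_norm_bounded ?_ (T_bound x y)
  have g1 : Summable (fun k : ℕ => (1/2 : ℝ)^k) := summable_geometric_of_lt_one (by norm_num) (by norm_num)
  have g2 : Summable (fun k : ℕ => (8 * ‖x‖)^k) := summable_geometric_of_lt_one (by positivity) (by linarith)
  have g3 : Summable (fun k : ℕ => (8 * ‖y‖)^k) := summable_geometric_of_lt_one (by positivity) (by linarith)
  exact g1.mul_of_nonneg (g2.mul_of_nonneg g3 (fun _ => by positivity) (fun _ => by positivity))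
    (fun _ => by positivity) (fun _ => by positivity)

lemma T_col (x y : ℂ) (p : ℕ × ℕ) : HasSum (fun k => T x y (k, p))
    ((((p.1 + p.2).choose p.1 : ℂ)) ^ 2 * x ^ p.1 * y ^ p.2) := by
  have : HasSum (fun k => T x y (k, p)) (∑ k ∈ Finset.range (p.1+1), T x y (k, p)) := hasSum_sum_of_ne_finset_zero (by
    intro k hk
    simp only [Finset.mem_range, not_lt] at hk
    simp [T, Nat.choose_eq_zero_of_lt (show p.1 < k by omega)])
  convert this using 1
  simp only [T]
  rw [← Finset.sum_mul, ← Finset.sum_mul, ← Nat.cast_sum]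
  congr 2
  simp only [mul_assoc]
  rw [← Finset.mul_sum, vand]
  push_cast; ring

lemma T_row (x y : ℂ) (hx : ‖x‖ < 1/16) (hy : ‖y‖ < 1/16) (k : ℕ) :
    HasSum (fun p => T x y (k, p)) (1 / (1 - x - y) * ((k.centralBinom : ℂ) * (x * y / (1 - x - y)^2)^k)) := by
  have hinj : Function.Injective (fun p : ℕ × ℕ => (p.1 + k, p.2 + k)) := by
    rintro ⟨a, b⟩ ⟨c, d⟩ h
    simpa using h
  have hs : Summable (fun p => T x y (k, p)) := (T_summable x y hx hy).prod_factor k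
  rw [← hinj.hasSum_iff (by
    rintro ⟨l, m⟩ h
    by_cases h1 : k ≤ l
    · by_cases h2 : k ≤ m
      · exact absurd ⟨(l - k, m - k), by simp [h1, h2]⟩ h
      · simp [T, Nat.choose_eq_zero_of_lt (not_le.1 h2)]
    · simp [T, Nat.choose_eq_zero_of_lt (not_le.1 h1)])]
  have hs' := hs.comp_injective hinj
  rw [← Finset.HasAntidiagonal.sigmaAntidiagonalEquivProd.summable_iff] at hs'
  rw [← Finset.HasAntidiagonal.sigmaAntidiagonalEquivProd.hasSum_iff]
  have hn : ‖x + y‖ < 1 := (norm_add_le _ _).trans_lt (by linarith)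
  have hw : 1 - x - y ≠ 0 := by
    intro h
    have : x + y = 1 := by linear_combination -h
    rw [this] at hn; simp at hn
  have h2 := ((hasSum_choose_mul_geometric_of_norm_lt_one (2*k) hn).mul_left
    ((k.centralBinom : ℂ) * (x*y)^k))
  have h3 := hs'.hasSum.sigma (fun n => hasSum_fintype _)
  refine hs'.hasSum_iff.2 ?_
  refine h3.unique ?_
  have e : 1 / (1 - x - y) * (k.centralBinom * (x * y / (1 - x - y) ^ 2) ^ k) =
    k.centralBinom * (x * y) ^ k * (1 / (1 - (x + y)) ^ (2 * k + 1)) := by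
    rw [div_pow, show 1 - (x + y) = 1 - x - y by ring]
    field_simp
    rw [← pow_mul]; ring
  rw [e]
  refine Eq.subst (motive := fun f => HasSum f _) (funext ?_) h2
  · intro n
    symm
    rw [Finset.univ_eq_attach, (Commute.all x y).add_pow']
    refine (Finset.sum_attach (Finset.HasAntidiagonal.antidiagonal n) (fun p => T x y (k, (p.1 + k, p.2 + k)))).trans ?_
    rw [Finset.mul_sum, Finset.mul_sum]
    refine Finset.sum_congr rfl fun p hp => ?_
    obtain ⟨a, b⟩ := p
    simp only [Finset.HasAntidiagonal.mem_antidiagonal] at hp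
    subst hp
    simp only [T, cb_id, nsmul_eq_mul]
    push_cast
    ring

theorem G2_eq_inv_sqrt_Q2 :
    ∃ ε > (0 : ℝ), ∀ x₁ x₂ : ℂ, ‖x₁‖ < ε → ‖x₂‖ < ε →
      HasSum (fun p : ℕ × ℕ => (((p.1 + p.2).choose p.1 : ℂ)) ^ 2 * x₁ ^ p.1 * x₂ ^ p.2)
        (1 / (Q2 x₁ x₂) ^ ((1 : ℂ) / 2)) := by
  refine ⟨1/16, by norm_num, fun x y hx hy => ?_⟩
  have hs := T_summable x y hx hy
  have hn : ‖x + y‖ < 1/8 := (norm_add_le _ _).trans_lt (by linarith)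
  have hwn : 7/8 < ‖1 - x - y‖ := by
    have := norm_sub_norm_le (1:ℂ) (x + y)
    rw [← sub_sub] at this
    simp at this; linarith
  have hw : 1 - x - y ≠ 0 := by
    rw [← norm_pos_iff]; linarith
  obtain ⟨u, hu⟩ : ∃ u, u = x * y / (1 - x - y)^2 := ⟨_, rfl⟩
  have hun : ‖u‖ < 1/64 := by
    rw [hu, norm_div, norm_mul, norm_pow, div_lt_iff₀ (by positivity)]
    have : ‖x‖ * ‖y‖ ≤ 1/16 * (1/16) := by gcongr
    nlinarith
  have h1 := (hasSum_central u (by linarith)).mul_left (1 / (1 - x - y))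
  have h2 := hs.hasSum.prod_fiberwise (T_row x y hx hy)
  rw [← hu] at h2
  have h3 := h2.unique h1
  have h4 := ((Equiv.prodComm ℕ (ℕ × ℕ)).symm.hasSum_iff.2 hs.hasSum).prod_fiberwise (fun p => T_col x y p)
  rw [h3] at h4
  convert h4 using 1
  obtain ⟨s, hsd⟩ : ∃ s, s = (1 - 4 * u) ^ ((1:ℂ)/2) := ⟨_, rfl⟩
  have hs2 : s ^ 2 = 1 - 4 * u := by
    rw [hsd, one_div]; exact Complex.cpow_nat_inv_pow _ two_ne_zero
  have hre : 0 ≤ s.re := by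
    rw [hsd, one_div, Complex.cpow_inv_two_re]; positivity
  have hs1 : ‖s - 1‖ < 1/16 := by
    have a1 : (s - 1) * (s + 1) = - 4 * u := by linear_combination hs2
    have a2 : 1 ≤ ‖s + 1‖ := by
      refine le_trans ?_ (Complex.re_le_norm _)
      simp [hre]
    have a3 : ‖s - 1‖ * ‖s + 1‖ = 4 * ‖u‖ := by rw [← norm_mul, a1]; simp
    nlinarith [norm_nonneg (s - 1)]
  have hpos : 0 < ((1 - x - y) * s).re := by
    have b1 : ‖1 - (1 - x - y) * s‖ < 1 := by
      have : 1 - (1 - x - y) * s = (x + y) - (s - 1) + (x + y) * (s - 1) := by ring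
      rw [this]
      refine (norm_add_le _ _).trans_lt ?_
      have c1 := norm_sub_le (x + y) (s - 1)
      rw [norm_mul]
      nlinarith [norm_nonneg (x + y), norm_nonneg (s - 1)]
    have b2 := Complex.re_le_norm (1 - (1 - x - y) * s)
    rw [Complex.sub_re, Complex.one_re] at b2
    linarith
  have hQ : Q2 x y = ((1 - x - y) * s) ^ 2 := by
    rw [mul_pow, hs2, hu, Q2]; field_simp
  rw [← hsd, hQ, one_div 2, Complex.sq_cpow_two_inv hpos, one_div, one_div, mul_inv]
end

section
/- As a formal power series identity in x' = (x₁,...,x_{n-1}) and x_n: G_n(x', x_n) = ∑_{k=0}^∞ (∏_{m=1}^k (𝒟' + m)²) G_{n-1}(x') · x_n^k / (k!)², where 𝒟' = δ_{x_1} + ... + δ_{x_{n-1}}. -/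
/-- Coefficient function of `G_n(x) = ∑_{ℓ∈ℕⁿ} (|ℓ|!/ℓ!)² x^ℓ`. -/
noncomputable def Gcoeff (n : ℕ) (ℓ : Fin n →₀ ℕ) : ℂ :=
  (((∑ j, ℓ j).factorial : ℂ) / ∏ j, ((ℓ j).factorial : ℂ)) ^ 2

/-- The Euler operator `δ_{x_j}` on coefficient functions. -/
noncomputable def eulerOp {n : ℕ} (j : Fin n) (f : (Fin n →₀ ℕ) → ℂ) :
    (Fin n →₀ ℕ) → ℂ :=
  fun ℓ => (ℓ j : ℂ) * f ℓ

/-- `𝒟' = δ_{x_1} + ⋯ + δ_{x_{n-1}}` (the Euler operator in the first `n-1` variables). -/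
noncomputable def DOp {n : ℕ} (f : (Fin n →₀ ℕ) → ℂ) : (Fin n →₀ ℕ) → ℂ :=
  fun ℓ => ∑ j, eulerOp j f ℓ

/-- The operator `𝒟' + m`. -/
noncomputable def shiftOp {n : ℕ} (m : ℕ) (f : (Fin n →₀ ℕ) → ℂ) :
    (Fin n →₀ ℕ) → ℂ :=
  fun ℓ => DOp f ℓ + (m : ℂ) * f ℓ

/-- The operator `∏_{m=1}^k (𝒟' + m)²`. -/
noncomputable def prodShiftOp {n : ℕ} : ℕ → ((Fin n →₀ ℕ) → ℂ) → ((Fin n →₀ ℕ) → ℂ)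
  | 0, f => f
  | k + 1, f => shiftOp (k + 1) (shiftOp (k + 1) (prodShiftOp k f))

theorem shiftOp_apply_eq {n : ℕ} (m : ℕ) (f : (Fin n →₀ ℕ) → ℂ) (ℓ : Fin n →₀ ℕ) :
    shiftOp m f ℓ = (((∑ j, ℓ j) + m : ℕ) : ℂ) * f ℓ := by
  simp only [shiftOp, DOp, eulerOp]
  rw [← Finset.sum_mul]
  push_cast
  ring

theorem prodShiftOp_mul_eq {n : ℕ} (k : ℕ) (f : (Fin n →₀ ℕ) → ℂ) (ℓ : Fin n →₀ ℕ) :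
    prodShiftOp k f ℓ * ((∑ j, ℓ j).factorial : ℂ) ^ 2 =
      (((∑ j, ℓ j) + k).factorial : ℂ) ^ 2 * f ℓ := by
  induction k with
  | zero => simp [prodShiftOp, mul_comm]
  | succ k ih =>
    rw [prodShiftOp, shiftOp_apply_eq, shiftOp_apply_eq, ← add_assoc, Nat.factorial_succ,
      Nat.cast_mul, mul_pow, mul_assoc (_ ^ 2), ← ih]
    ring

/-- As a formal power series identity in `x' = (x₁,…,x_{n-1})` and `x_n`:
`G_n(x', x_n) = ∑_{k≥0} (∏_{m=1}^k (𝒟' + m)²) G_{n-1}(x') · x_n^k/(k!)²`.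
Coefficientwise: the coefficient of `G_n` at the exponent `(ℓ, k)` (exponent `ℓ` in the
first `n-1` variables and `k` in the last one) equals
`(∏_{m=1}^k (𝒟' + m)² G_{n-1})_ℓ / (k!)²`. -/
theorem Gn_eq_series_of_Gn_sub_one (n : ℕ) (ℓ : Fin n →₀ ℕ) (k : ℕ) :
    Gcoeff (n + 1)
        (ℓ.embDomain (Fin.castSuccEmb) + Finsupp.single (Fin.last n) k) =
      prodShiftOp k (Gcoeff n) ℓ / ((k.factorial : ℂ)) ^ 2 := by
  have h1 : ∀ j : Fin n, (ℓ.embDomain (Fin.castSuccEmb) + Finsupp.single (Fin.last n) k)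
      j.castSucc = ℓ j := by
    intro j
    have := Finsupp.embDomain_apply_self (Fin.castSuccEmb (n := n)) ℓ j
    rw [Fin.coe_castSuccEmb] at this
    rw [Finsupp.add_apply, this, Finsupp.single_eq_of_ne (Fin.castSucc_lt_last j).ne, add_zero]
  have h2 : (ℓ.embDomain (Fin.castSuccEmb) + Finsupp.single (Fin.last n) k)
      (Fin.last n) = k := by
    rw [Finsupp.add_apply, Finsupp.embDomain_notin_range, Finsupp.single_eq_same, zero_add]
    rintro ⟨j, hj⟩
    exact (Fin.castSucc_lt_last j).ne hj
  have h3 := prodShiftOp_mul_eq k (Gcoeff n) ℓ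
  have hs : ((∑ j, ℓ j).factorial : ℂ) ≠ 0 := Nat.cast_ne_zero.mpr (Nat.factorial_ne_zero _)
  have hk : (k.factorial : ℂ) ≠ 0 := Nat.cast_ne_zero.mpr (Nat.factorial_ne_zero _)
  have hp : (∏ j, ((ℓ j).factorial : ℂ)) ≠ 0 :=
    Finset.prod_ne_zero_iff.mpr fun j _ => Nat.cast_ne_zero.mpr (Nat.factorial_ne_zero _)
  rw [← eq_div_iff (pow_ne_zero 2 hs)] at h3
  rw [h3]
  simp only [Gcoeff, Fin.sum_univ_castSucc, Fin.prod_univ_castSucc, h1, h2]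
  field_simp
end

section
/- For H₂(x₁,x₂) = √(Q₂(x₁,x₂)) · G₂(x₁,x₂) with Q₂(x,y) = (1-x-y)² - 4xy, one has H₂ ≡ 1 near the origin; equivalently, G₂(x₁,x₂)² · Q₂(x₁,x₂) = 1 for all (x₁,x₂) near (0,0) in ℂ². -/
/-- The sum of the double series `G₂(x₁,x₂) = ∑_{ℓ,m} (binom(ℓ+m,ℓ))² x₁^ℓ x₂^m`. -/
noncomputable def G2 (x₁ x₂ : ℂ) : ℂ :=
  ∑' p : ℕ × ℕ, (((p.1 + p.2).choose p.1 : ℂ)) ^ 2 * x₁ ^ p.1 * x₂ ^ p.2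

open PowerSeries in
theorem aux_ps : ((1 - 4 * X) * (mk fun n => (n.centralBinom : ℚ)) ^ 2 : ℚ⟦X⟧) = 1 := by
  set S : ℚ⟦X⟧ := mk fun n => (n.centralBinom : ℚ) with hS
  have h4 : (4 : ℚ⟦X⟧) = C (4 : ℚ) := (map_ofNat C 4).symm
  have hD : (1 - 4 * X) * (d⁄dX ℚ S) = 2 * S := by
    ext n
    have h2 : (2 : ℚ⟦X⟧) = C (2 : ℚ) := (map_ofNat C 2).symm
    rw [sub_mul, one_mul, h4, h2, mul_assoc, map_sub, coeff_C_mul, coeff_C_mul, coeff_derivative]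
    rcases n with _ | n
    · simp [hS, Nat.centralBinom]
    · rw [coeff_succ_X_mul, coeff_derivative]
      simp only [hS, coeff_mk]
      have := Nat.succ_mul_centralBinom_succ (n + 1)
      have h : ((n + 1 + 1 : ℕ) : ℚ) * ((n + 1 + 1).centralBinom : ℚ)
          = 2 * (2 * (n + 1 : ℕ) + 1) * ((n + 1).centralBinom : ℚ) := by exact_mod_cast this
      push_cast at h ⊢
      linarith
  apply derivative.ext
  · have h4' : d⁄dX ℚ (4 : ℚ⟦X⟧) = 0 := by rw [h4, derivative_C]
    simp only [Derivation.leibniz, Derivation.leibniz_pow, map_sub, derivative_one, derivative_X,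
      h4', smul_eq_mul]
    simp only [nsmul_eq_mul]
    push_cast
    linear_combination 2 * S * hD
  · simp [hS]

open PowerSeries in
theorem aux_coeff (n : ℕ) : ∑ p ∈ Finset.HasAntidiagonal.antidiagonal n,
    p.1.centralBinom * p.2.centralBinom = 4 ^ n := by
  set S : ℚ⟦X⟧ := mk fun n => (n.centralBinom : ℚ) with hS
  have h4 : (4 : ℚ⟦X⟧) = C (4 : ℚ) := (map_ofNat C 4).symm
  have key : ∀ n, coeff n (S ^ 2) = (4 : ℚ) ^ n := by
    intro n
    induction n with
    | zero => simp [hS]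
    | succ n ih =>
      have := congrArg (coeff (n + 1)) aux_ps
      rw [← hS, sub_mul, one_mul, h4, mul_assoc, map_sub, coeff_C_mul, coeff_succ_X_mul, ih,
        coeff_one, if_neg (by omega)] at this
      rw [pow_succ (4 : ℚ)]; linarith
  have := key n
  rw [pow_two, coeff_mul] at this
  simp only [hS, coeff_mk] at this
  exact_mod_cast this

theorem aux_summable (z : ℂ) (hz : ‖z‖ < 1 / 4) :
    Summable fun n : ℕ => ‖(n.centralBinom : ℂ) * z ^ n‖ := by
  refine Summable.of_nonneg_of_le (fun _ => norm_nonneg _) (fun n => ?_)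
    (summable_geometric_of_lt_one (r := 4 * ‖z‖) (by positivity) (by linarith))
  rw [norm_mul, norm_pow, mul_pow, Complex.norm_natCast]
  gcongr
  exact_mod_cast Nat.centralBinom_le_four_pow n

theorem aux_S (z : ℂ) (hz : ‖z‖ < 1 / 4) :
    (∑' n : ℕ, (n.centralBinom : ℂ) * z ^ n) ^ 2 * (1 - 4 * z) = 1 := by
  have hs := aux_summable z hz
  rw [pow_two, tsum_mul_tsum_eq_tsum_sum_antidiagonal_of_summable_norm hs hs]
  have : ∀ n : ℕ, ∑ p ∈ Finset.HasAntidiagonal.antidiagonal n,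
      ((p.1.centralBinom : ℂ) * z ^ p.1) * ((p.2.centralBinom : ℂ) * z ^ p.2) = (4 * z) ^ n := by
    intro n
    have h := congrArg (Nat.cast : ℕ → ℂ) (aux_coeff n)
    push_cast at h
    rw [mul_pow, ← h, Finset.sum_mul]
    refine Finset.sum_congr rfl fun p hp => ?_
    rw [← Finset.HasAntidiagonal.mem_antidiagonal.mp hp, pow_add]; ring
  simp_rw [this]
  have h4 : ‖4 * z‖ < 1 := by rw [norm_mul]; norm_num; linarith
  rw [tsum_geometric_of_norm_lt_one h4]
  apply inv_mul_cancel₀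
  intro h0
  have : (4 * z) = 1 := by linear_combination -h0
  rw [this] at h4; simp at h4

theorem aux_vander (l m : ℕ) :
    ∑ k ∈ Finset.range (l + 1), l.choose k * m.choose k = (l + m).choose l := by
  rw [add_comm l m, Nat.add_choose_eq, ← Finset.Nat.sum_antidiagonal_eq_sum_range_succ_mk
    (f := fun p : ℕ × ℕ => l.choose p.1 * m.choose p.1)]
  refine Finset.sum_congr rfl fun p hp => ?_
  have := Finset.HasAntidiagonal.mem_antidiagonal.mp hp
  subst this
  rw [mul_comm, Nat.choose_symm_add]

theorem aux_choose (k a b : ℕ) :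
    ((k + a) + (k + b)).choose (k + a) * (k + a).choose k * (k + b).choose k
      = k.centralBinom * ((a + b) + 2 * k).choose (2 * k) * (a + b).choose a := by
  have e1 := Nat.add_choose_mul_factorial_mul_factorial (k + a) (k + b)
  have e2 := Nat.add_choose_mul_factorial_mul_factorial k a
  have e3 := Nat.add_choose_mul_factorial_mul_factorial k b
  have e4 := Nat.add_choose_mul_factorial_mul_factorial k k
  have e5 := Nat.add_choose_mul_factorial_mul_factorial (2 * k) (a + b)
  have e6 := Nat.add_choose_mul_factorial_mul_factorial a b
  rw [← Nat.choose_symm_add] at e1 e2 e3 e4 e5 e6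
  rw [← two_mul] at e4
  rw [add_comm (2 * k) (a + b)] at e5
  rw [show k + a + (k + b) = a + b + 2 * k by ring] at e1 ⊢
  unfold Nat.centralBinom
  have hp : 0 < k.factorial * k.factorial * a.factorial * b.factorial := by positivity
  apply Nat.eq_of_mul_eq_mul_right hp
  rw [← e4, ← e6] at e5
  rw [← e2, ← e3] at e1
  linarith

/-- The triple summand. -/
noncomputable def auxF (x y : ℂ) (p : ℕ × (ℕ × ℕ)) : ℂ :=
  (p.1.centralBinom : ℂ) * (((p.2.1 + p.2.2) + 2 * p.1).choose (2 * p.1) : ℂ)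
    * ((p.2.1 + p.2.2).choose p.2.1 : ℂ) * (x * y) ^ p.1 * x ^ p.2.1 * y ^ p.2.2

theorem auxF_summable (x y : ℂ) (hx : ‖x‖ < 1 / 16) (hy : ‖y‖ < 1 / 16) :
    Summable (auxF x y) := by
  have g : Summable fun n : ℕ => (1 / 4 : ℝ) ^ n :=
    summable_geometric_of_lt_one (by norm_num) (by norm_num)
  have g' : Summable fun n : ℕ => (1 / 16 : ℝ) ^ n :=
    summable_geometric_of_lt_one (by norm_num) (by norm_num)
  have G : Summable fun p : ℕ × (ℕ × ℕ) =>
      (1 / 16 : ℝ) ^ p.1 * ((1 / 4 : ℝ) ^ p.2.1 * (1 / 4 : ℝ) ^ p.2.2) :=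
    g'.mul_of_nonneg (g.mul_of_nonneg g (fun _ => by positivity) (fun _ => by positivity))
      (fun _ => by positivity) (fun _ => by positivity)
  refine Summable.of_norm_bounded G ?_
  rintro ⟨k, a, b⟩
  simp only [auxF, norm_mul, norm_pow, Complex.norm_natCast]
  have h1 : (k.centralBinom : ℝ) ≤ 4 ^ k := by exact_mod_cast Nat.centralBinom_le_four_pow k
  have h2 : ((a + b + 2 * k).choose (2 * k) : ℝ) ≤ 2 ^ (a + b + 2 * k) := by
    exact_mod_cast Nat.choose_le_two_pow _ _
  have h3 : ((a + b).choose a : ℝ) ≤ 2 ^ (a + b) := by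
    exact_mod_cast Nat.choose_le_two_pow _ _
  calc _ ≤ (4 : ℝ) ^ k * 2 ^ (a + b + 2 * k) * 2 ^ (a + b) * (1 / 16 * (1 / 16)) ^ k
        * (1 / 16) ^ a * (1 / 16) ^ b := by gcongr
    _ = ((4 * 2 ^ 2 * (1 / 16 * (1 / 16)) : ℝ)) ^ k * ((2 * 2 * (1 / 16) : ℝ) ^ a
        * (2 * 2 * (1 / 16) : ℝ) ^ b) := by
      simp only [mul_pow, pow_add, pow_mul]; ring
    _ = _ := by norm_num

theorem aux_G2 (x y : ℂ) (hx : ‖x‖ < 1 / 16) (hy : ‖y‖ < 1 / 16) :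
    G2 x y = ∑' p, auxF x y p := by
  let i : ℕ × (ℕ × ℕ) → (ℕ × ℕ) × ℕ := fun p => ((p.1 + p.2.1, p.1 + p.2.2), p.1)
  let F : (ℕ × ℕ) × ℕ → ℂ := fun q =>
    ((q.1.1 + q.1.2).choose q.1.1 : ℂ) * (q.1.1.choose q.2 : ℂ) * (q.1.2.choose q.2 : ℂ)
      * x ^ q.1.1 * y ^ q.1.2
  have hi : Function.Injective i := by
    rintro ⟨k, a, b⟩ ⟨k', a', b'⟩ h
    simp only [i, Prod.mk.injEq] at h ⊢
    omega
  have hF0 : ∀ q, q ∉ Set.range i → F q = 0 := by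
    rintro ⟨⟨l, m⟩, k⟩ hq
    by_cases h : k ≤ l ∧ k ≤ m
    · exact absurd ⟨(k, l - k, m - k), by
        simp only [i, Prod.mk.injEq, and_true]; omega⟩ hq
    · simp only [F]
      rcases not_and_or.mp h with h | h
      · rw [Nat.choose_eq_zero_of_lt (not_le.mp h)]; simp
      · rw [Nat.choose_eq_zero_of_lt (n := m) (not_le.mp h)]; simp
  have hFi : F ∘ i = auxF x y := by
    funext ⟨k, a, b⟩
    have h := congrArg (Nat.cast : ℕ → ℂ) (aux_choose k a b)
    push_cast at h
    simp only [F, i, Function.comp, auxF]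
    rw [← h]
    ring
  have hsF : Summable F := by
    rw [← hi.summable_iff hF0, hFi]; exact auxF_summable x y hx hy
  have ht : ∑' p, auxF x y p = ∑' q, F q := by
    rw [← hFi]
    exact hi.tsum_eq (f := F) fun q hq => by
      by_contra h
      exact hq (hF0 q h)
  rw [ht, hsF.tsum_prod, G2]
  refine tsum_congr ?_
  rintro ⟨l, m⟩
  rw [tsum_eq_sum (s := Finset.range (l + 1))]
  · have h := congrArg (Nat.cast : ℕ → ℂ) (aux_vander l m)
    push_cast at h
    simp only [F]
    rw [pow_two]
    nth_rewrite 2 [← h]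
    simp only [Finset.mul_sum, Finset.sum_mul]
    exact Finset.sum_congr rfl fun k _ => by ring
  · intro k hk
    simp only [F]
    rw [Nat.choose_eq_zero_of_lt (n := l) (k := k) (by simpa using hk)]; simp

theorem aux_inner (x y : ℂ) (hx : ‖x‖ < 1 / 16) (hy : ‖y‖ < 1 / 16) (k : ℕ) :
    ∑' p : ℕ × ℕ, auxF x y (k, p)
      = (k.centralBinom : ℂ) * (x * y) ^ k * (1 / (1 - (x + y)) ^ (2 * k + 1)) := by
  have hs : Summable fun p : ℕ × ℕ => auxF x y (k, p) := (auxF_summable x y hx hy).prod_factor k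
  have hr : ‖x + y‖ < 1 := by linarith [norm_add_le x y]
  rw [← tsum_choose_mul_geometric_of_norm_lt_one (2 * k) hr, ← tsum_mul_left,
    ← Finset.HasAntidiagonal.sigmaAntidiagonalEquivProd.tsum_eq]
  refine (Summable.tsum_sigma
      ((Finset.HasAntidiagonal.sigmaAntidiagonalEquivProd.summable_iff).mpr hs)).trans ?_
  refine tsum_congr fun n => ?_
  rw [tsum_fintype]
  simp only [Function.comp_apply]
  simp only [Finset.HasAntidiagonal.sigmaAntidiagonalEquivProd_apply]
  rw [Finset.sum_coe_sort (Finset.HasAntidiagonal.antidiagonal n) (fun p => auxF x y (k, p)),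
    (Commute.all x y).add_pow', Finset.mul_sum, Finset.mul_sum]
  refine Finset.sum_congr rfl fun p hp => ?_
  have := Finset.HasAntidiagonal.mem_antidiagonal.mp hp
  subst this
  simp only [auxF, nsmul_eq_mul]
  ring

/-- `H₂ = √(Q₂) · G₂ ≡ 1` near the origin; equivalently,
`G₂(x₁,x₂)² · Q₂(x₁,x₂) = 1` for all `(x₁,x₂)` near `(0,0)`. -/
theorem G2_sq_mul_Q2_eq_one :
    ∃ ε > (0 : ℝ), ∀ x₁ x₂ : ℂ, ‖x₁‖ < ε → ‖x₂‖ < ε →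
      (G2 x₁ x₂) ^ 2 * Q2 x₁ x₂ = 1 := by
  refine ⟨1 / 16, by norm_num, fun x y hx hy => ?_⟩
  have hw : 7 / 8 ≤ ‖1 - (x + y)‖ := by
    have h1 := norm_sub_norm_le 1 (x + y)
    have h2 := norm_add_le x y
    rw [norm_one] at h1
    linarith
  set w := 1 - (x + y) with hwd
  have hw0 : w ≠ 0 := by
    intro h; rw [h, norm_zero] at hw; norm_num at hw
  have hz : ‖x * y / w ^ 2‖ < 1 / 4 := by
    rw [norm_div, norm_mul, norm_pow, div_lt_iff₀ (by positivity)]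
    nlinarith [norm_nonneg x, norm_nonneg y, mul_le_mul hx.le hy.le (norm_nonneg y) (by norm_num)]
  have hG : G2 x y = 1 / w * ∑' k : ℕ, (k.centralBinom : ℂ) * (x * y / w ^ 2) ^ k := by
    rw [aux_G2 x y hx hy, (auxF_summable x y hx hy).tsum_prod, ← tsum_mul_left]
    refine tsum_congr fun k => ?_
    rw [aux_inner x y hx hy k, ← hwd, div_pow, pow_succ, pow_mul]
    field_simp
  have hQ : Q2 x y = w ^ 2 * (1 - 4 * (x * y / w ^ 2)) := by
    rw [Q2]
    field_simp
    rw [hwd]; ring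
  have hS := aux_S _ hz
  rw [hG, hQ, mul_pow]
  calc _ = (1 / w) ^ 2 * w ^ 2 * ((∑' k : ℕ, (k.centralBinom : ℂ) * (x * y / w ^ 2) ^ k) ^ 2
        * (1 - 4 * (x * y / w ^ 2))) := by ring
    _ = 1 := by rw [hS]; field_simp
end

section
/- For complex x, y, z, u(x,y,z) = 64xyz/Q(x,y,z)² equals 1 if and only if there exist signs ε₁, ε₂, ε₃ ∈ {±1} and square roots √x, √y, √z such that ε₁√x + ε₂√y + ε₃√z = 1, where Q(x,y,z) = (1-(x+y+z))² - 4(xy+yz+zx) and Q(x,y,z) ≠ 0. -/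
/-- `Q(x,y,z) = (1-(x+y+z))² - 4(xy+yz+zx)`. -/
noncomputable def Q3 (x y z : ℂ) : ℂ :=
  (1 - (x + y + z)) ^ 2 - 4 * (x * y + y * z + z * x)

/-- The product over all eight sign choices equals `Q² - 64xyz`. -/
theorem octic_factor (a b c : ℂ) :
    (Q3 (a ^ 2) (b ^ 2) (c ^ 2)) ^ 2 - 64 * a ^ 2 * b ^ 2 * c ^ 2 =
      (1 - a - b - c) * (1 - a + b + c) * (1 + a - b + c) * (1 + a + b - c) *
      (1 + a + b + c) * (1 + a - b - c) * (1 - a + b - c) * (1 - a - b + c) := by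
  unfold Q3
  ring

/-- For complex `x, y, z` with `Q(x,y,z) ≠ 0`, `u = 64xyz/Q²` equals `1` if and only if
there exist signs `ε₁, ε₂, ε₃ ∈ {±1}` and square roots `a, b, c` of `x, y, z` such
that `ε₁a + ε₂b + ε₃c = 1`. -/
theorem u_eq_one_iff (x y z : ℂ) (hQ : Q3 x y z ≠ 0) :
    64 * x * y * z / (Q3 x y z) ^ 2 = 1 ↔
      ∃ a b c ε₁ ε₂ ε₃ : ℂ, a ^ 2 = x ∧ b ^ 2 = y ∧ c ^ 2 = z ∧
        (ε₁ = 1 ∨ ε₁ = -1) ∧ (ε₂ = 1 ∨ ε₂ = -1) ∧ (ε₃ = 1 ∨ ε₃ = -1) ∧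
        ε₁ * a + ε₂ * b + ε₃ * c = 1 := by
  have hQ2 : (Q3 x y z) ^ 2 ≠ 0 := pow_ne_zero 2 hQ
  rw [div_eq_one_iff_eq hQ2]
  constructor
  · intro h
    obtain ⟨a, ha⟩ := IsAlgClosed.exists_pow_nat_eq x (n := 2) (by norm_num)
    obtain ⟨b, hb⟩ := IsAlgClosed.exists_pow_nat_eq y (n := 2) (by norm_num)
    obtain ⟨c, hc⟩ := IsAlgClosed.exists_pow_nat_eq z (n := 2) (by norm_num)
    have key := octic_factor a b c
    rw [ha, hb, hc, ← h, sub_self] at key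
    have key' := key.symm
    simp only [mul_eq_zero] at key'
    rcases key' with ((((((h0 | h0) | h0) | h0) | h0) | h0) | h0) | h0
    · exact ⟨a, b, c, 1, 1, 1, ha, hb, hc, by simp, by simp, by simp, by linear_combination -h0⟩
    · exact ⟨a, b, c, 1, -1, -1, ha, hb, hc, by simp, by simp, by simp, by linear_combination -h0⟩
    · exact ⟨a, b, c, -1, 1, -1, ha, hb, hc, by simp, by simp, by simp, by linear_combination -h0⟩
    · exact ⟨a, b, c, -1, -1, 1, ha, hb, hc, by simp, by simp, by simp, by linear_combination -h0⟩
    · exact ⟨a, b, c, -1, -1, -1, ha, hb, hc, by simp, by simp, by simp, by linear_combination -h0⟩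
    · exact ⟨a, b, c, -1, 1, 1, ha, hb, hc, by simp, by simp, by simp, by linear_combination -h0⟩
    · exact ⟨a, b, c, 1, -1, 1, ha, hb, hc, by simp, by simp, by simp, by linear_combination -h0⟩
    · exact ⟨a, b, c, 1, 1, -1, ha, hb, hc, by simp, by simp, by simp, by linear_combination -h0⟩
  · rintro ⟨a, b, c, e, f, g, rfl, rfl, rfl, he, hf, hg, h⟩
    have he2 : e ^ 2 = 1 := by rcases he with rfl | rfl <;> norm_num
    have hf2 : f ^ 2 = 1 := by rcases hf with rfl | rfl <;> norm_num
    have hg2 : g ^ 2 = 1 := by rcases hg with rfl | rfl <;> norm_num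
    have key := octic_factor (e * a) (f * b) (g * c)
    have h0 : 1 - e * a - f * b - g * c = 0 := by linear_combination -h
    rw [h0] at key
    simp only [mul_pow, he2, hf2, hg2, one_mul, zero_mul] at key
    linear_combination -key
end
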